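/- Let (X_n)_{n∈ℤ} be a weakly stationary zero-mean process in L²_H with Σ_{h∈ℤ}‖C_{X;h}‖_L < ∞ so that the spectral density operator F_X[ω] is well defined, let (ν_i)_{i∈ℕ} be an orthonormal basis of H, D ∈ ℕ, and X_{D,n} = P_{A_D}X_n. Then for every ω ∈ (−π,π] the spectral density operator of the projected process satisfies F_{X_D}[ω] = P_{A_D} F_X[ω] P_{A_D}. If in addition (X_n) is a stationary, invertible functional linear process with Σ_{j=0}^∞ ‖ψ_j‖_L < ∞ and all eigenvalues of C_ε positive, then ⟨F_{X_D}[ω]x, x⟩ > 0 for every nonzero x ∈ A_D. -/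

import Mathlib

open MeasureTheory Filter
open scoped RealInnerProductSpace Topology

noncomputable section

namespace FLP

variable {Ω : Type*} [MeasurableSpace Ω]
variable {H : Type*} [NormedAddCommGroup H] [InnerProductSpace ℝ H] [CompleteSpace H]

/-- The rank-one operator `x ⊗ y : z ↦ ⟪x, z⟫ • y`. -/
def outer (x y : H) : H →L[ℝ] H := (innerSL ℝ x).smulRight y

/-- The cross covariance operator `C_{X,Y} = E[X ⊗ Y]`, i.e. `y ↦ E[⟪X, y⟫ Y]`. -/
def crossCov (μ : Measure Ω) (X Y : Ω → H) : H →L[ℝ] H :=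
  ∫ ω, outer (X ω) (Y ω) ∂μ

/-- The covariance operator `C_X = E[X ⊗ X]`. -/
def covOp (μ : Measure Ω) (X : Ω → H) : H →L[ℝ] H := crossCov μ X X

/-- White noise in `L²_H`. -/
def IsWhiteNoise (μ : Measure Ω) (ε : ℤ → Ω → H) : Prop :=
  (∀ n, MemLp (ε n) 2 μ) ∧
  (∀ n, ∫ ω, ε n ω ∂μ = 0) ∧
  (0 < ∫ ω, ‖ε 0 ω‖ ^ 2 ∂μ) ∧
  (∀ n, covOp μ (ε n) = covOp μ (ε 0)) ∧
  (∀ n m : ℤ, n ≠ m → crossCov μ (ε n) (ε m) = 0)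

/-- Weak stationarity: zero mean and cross covariances depending only on the lag. -/
def IsWeaklyStationary (μ : Measure Ω) (X : ℤ → Ω → H) : Prop :=
  (∀ n, MemLp (X n) 2 μ) ∧
  (∀ n, ∫ ω, X n ω ∂μ = 0) ∧
  (∀ n m k : ℤ, crossCov μ (X (n + k)) (X (m + k)) = crossCov μ (X n) (X m))

/-- A functional linear process `X_n = Σ_{j≥0} ψ_j ε_{n-j}` (series converging in `L²_H`). -/
structure IsFLP (μ : Measure Ω) (X ε : ℤ → Ω → H) (ψ : ℕ → H →L[ℝ] H) : Prop where
  whiteNoise : IsWhiteNoise μ ε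
  psi_zero : ψ 0 = ContinuousLinearMap.id ℝ H
  summable_sq : Summable fun j => ‖ψ j‖ ^ 2
  memLp : ∀ n, MemLp (X n) 2 μ
  repr : ∀ n : ℤ, Tendsto
    (fun N : ℕ => ∫ ω, ‖X n ω - ∑ j ∈ Finset.range N, ψ j (ε (n - j) ω)‖ ^ 2 ∂μ)
    atTop (𝓝 0)

/-- Invertibility: `X_n = ε_n + Σ_{j≥1} π_j X_{n-j}` (series converging in `L²_H`),
with `Σ_{j≥1} ‖π_j‖ < ∞`.  (`piOp 0` is irrelevant.) -/
def IsInvertible (μ : Measure Ω) (X ε : ℤ → Ω → H) (piOp : ℕ → H →L[ℝ] H) : Prop :=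
  (Summable fun j : ℕ => ‖piOp (j + 1)‖) ∧
  ∀ n : ℤ, Tendsto
    (fun N : ℕ => ∫ ω,
      ‖X n ω - ε n ω - ∑ j ∈ Finset.range N, piOp (j + 1) (X (n - (j + 1)) ω)‖ ^ 2 ∂μ)
    atTop (𝓝 0)

/-- The orthogonal projection onto `A_D = span{ν_0, …, ν_{D-1}}` (for `ν` orthonormal). -/
def proj (ν : ℕ → H) (D : ℕ) : H →L[ℝ] H :=
  ∑ i ∈ Finset.range D, (innerSL ℝ (ν i)).smulRight (ν i)

/-- Finite linear combinations `Σ l_i f_i` with bounded operators `l_i` and `f_i ∈ F`. -/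
def linComb (F : Set (Ω → H)) : Set (Ω → H) :=
  {g | ∃ (k : ℕ) (l : Fin k → H →L[ℝ] H) (f : Fin k → Ω → H),
      (∀ i, f i ∈ F) ∧ g = fun ω => ∑ i, l i (f i ω)}

/-- `Xhat` is the best linear predictor of `X` based on `F`, i.e. the orthogonal projection
in `L²_H` of `X` onto the `L`-closed subspace `LCS(F)` generated by `F`:
`Xhat` is square integrable, lies in the `L²`-closure of the linear combinations of
elements of `F`, and `X - Xhat` is orthogonal to them. -/
def IsBLP (μ : Measure Ω) (F : Set (Ω → H)) (X Xhat : Ω → H) : Prop :=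
  MemLp Xhat 2 μ ∧
  (∀ δ : ℝ, 0 < δ → ∃ g ∈ linComb F, ∫ ω, ‖Xhat ω - g ω‖ ^ 2 ∂μ < δ) ∧
  (∀ g ∈ linComb F, ∫ ω, ⟪X ω - Xhat ω, g ω⟫ ∂μ = 0)

/-- The trace of an operator along an orthonormal basis `ν`; for the self-adjoint
non-negative operators appearing below this is the nuclear norm `‖·‖_N`
(cf. the definition of `‖A‖_N = Σ_j ⟨A e_j, e_j⟩` in the paper). -/
def traceAlong (ν : ℕ → H) (T : H →L[ℝ] H) : ℝ := ∑' i : ℕ, ⟪T (ν i), ν i⟫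

/-- The nuclear norm of an operator: `sup Σ_i |⟨T e_i, f_i⟩|` over orthonormal
sequences `(e_i)`, `(f_i)`. -/
def nuclearNorm (T : H →L[ℝ] H) : ℝ :=
  ⨆ p : {p : (ℕ → H) × (ℕ → H) // Orthonormal ℝ p.1 ∧ Orthonormal ℝ p.2},
    ∑' i : ℕ, |⟪T (p.1.1 i), p.1.2 i⟫|


/-- Real part of `F_X[ω](x + iy)`, where
`F_X[ω] = (1/2π) Σ_{h∈ℤ} C_{X;h} e^{−ihω}` is the spectral density operator acting on
the complexification of `H` (a complex vector is encoded as a pair `(x, y) = x + iy`). -/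
def specRe (μ : Measure Ω) (X : ℤ → Ω → H) (ω : ℝ) (x y : H) : H :=
  (1 / (2 * Real.pi)) •
    ∑' h : ℤ, (Real.cos (h * ω) • crossCov μ (X 0) (X h) x +
      Real.sin (h * ω) • crossCov μ (X 0) (X h) y)

/-- Imaginary part of `F_X[ω](x + iy)`; see `specRe`. -/
def specIm (μ : Measure Ω) (X : ℤ → Ω → H) (ω : ℝ) (x y : H) : H :=
  (1 / (2 * Real.pi)) •
    ∑' h : ℤ, (Real.cos (h * ω) • crossCov μ (X 0) (X h) y -
      Real.sin (h * ω) • crossCov μ (X 0) (X h) x)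

set_option linter.unusedSectionVars false

/-! ### Abstract Hilbert space part -/

section Abstract

variable {H K : Type*} [NormedAddCommGroup H] [InnerProductSpace ℝ H] [CompleteSpace H]
  [NormedAddCommGroup K] [InnerProductSpace ℝ K]

/-- extension by zero to the integers -/
def extZ (φ : ℕ → H →L[ℝ] H) (j : ℤ) : H →L[ℝ] H := if 0 ≤ j then φ j.toNat else 0

lemma extZ_nat (φ : ℕ → H →L[ℝ] H) (j : ℕ) : extZ φ (j : ℤ) = φ j := by
  simp [extZ]

lemma extZ_neg (φ : ℕ → H →L[ℝ] H) {j : ℤ} (hj : j < 0) : extZ φ j = 0 := by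
  simp [extZ, hj]

lemma extZ_hasSum (φ : ℕ → H →L[ℝ] H) (c : ℤ → ℝ) (x a : H)
    (h : HasSum (fun j : ℕ => c j • φ j x) a) :
    HasSum (fun j : ℤ => c j • extZ φ j x) a := by
  have hi : Function.Injective (fun j : ℕ => (j : ℤ)) := Nat.cast_injective
  rw [← hi.hasSum_iff]
  · simpa [Function.comp_def, extZ_nat] using h
  · intro j hj
    have : j < 0 := by
      by_contra hc
      exact hj ⟨j.toNat, by simp; omega⟩
    simp [extZ_neg φ this]

lemma extZ_summable_norm (φ : ℕ → H →L[ℝ] H) (h : Summable fun j => ‖φ j‖) :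
    Summable fun j : ℤ => ‖extZ φ j‖ := by
  have hi : Function.Injective (fun j : ℕ => (j : ℤ)) := Nat.cast_injective
  rw [← hi.summable_iff]
  · simpa [Function.comp_def, extZ_nat] using h
  · intro j hj
    have : j < 0 := by
      by_contra hc
      exact hj ⟨j.toNat, by simp; omega⟩
    simp [extZ_neg φ this]

variable (T Z : ℤ → H →L[ℝ] K) (φ : ℕ → H →L[ℝ] H)

lemma inner_Z_T (horth : ∀ n m a b, ⟪T n a, T m b⟫ = if n = m then ⟪T 0 a, T 0 b⟫ else 0)
    (hZ : ∀ n a, Tendsto (fun N : ℕ => ∑ j ∈ Finset.range N, T (n - j) (φ j a)) atTop (𝓝 (Z n a)))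
    (n m : ℤ) (x b : H) : ⟪Z n x, T m b⟫ = ⟪T 0 (extZ φ (n - m) x), T 0 b⟫ := by
  have h1 : Tendsto (fun N : ℕ => ⟪∑ j ∈ Finset.range N, T (n - j) (φ j x), T m b⟫) atTop
      (𝓝 ⟪Z n x, T m b⟫) := (hZ n x).inner tendsto_const_nhds
  refine tendsto_nhds_unique h1 (tendsto_const_nhds.congr' ?_)
  filter_upwards [eventually_gt_atTop (n - m).toNat] with N hN
  rw [sum_inner]
  simp only [horth (n - _) m]
  by_cases hnm : 0 ≤ n - m
  · rw [Finset.sum_eq_single (n - m).toNat]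
    · rw [if_pos (by omega)]
      rw [extZ, if_pos hnm]
    · intro j _ hj
      rw [if_neg (by omega)]
    · intro h
      simp at h; omega
  · rw [extZ_neg φ (by omega), Finset.sum_eq_zero]
    · simp
    · intro j _
      rw [if_neg (by omega)]

lemma conv_id (horth : ∀ n m a b, ⟪T n a, T m b⟫ = if n = m then ⟪T 0 a, T 0 b⟫ else 0)
    (hinj : ∀ a, T 0 a = 0 → a = 0)
    (hZ : ∀ n a, Tendsto (fun N : ℕ => ∑ j ∈ Finset.range N, T (n - j) (φ j a)) atTop (𝓝 (Z n a)))
    (ρ : ℕ → H →L[ℝ] H)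
    (hI : ∀ a, Tendsto (fun N : ℕ => Z 0 a - T 0 a -
      ∑ l ∈ Finset.range N, Z (0 - (l + 1)) (ρ l a)) atTop (𝓝 0))
    (k : ℕ) (x : H) :
    φ k x - (if k = 0 then x else 0) - ∑ l ∈ Finset.range k, φ (k - 1 - l) (ρ l x) = 0 := by
  set w := φ k x - (if k = 0 then x else 0) - ∑ l ∈ Finset.range k, φ (k - 1 - l) (ρ l x) with hw
  apply hinj
  rw [← inner_self_eq_zero (𝕜 := ℝ)]
  have h1 : Tendsto (fun N : ℕ => ⟪Z 0 x - T 0 x -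
      ∑ l ∈ Finset.range N, Z (0 - (l + 1)) (ρ l x), T (-k) w⟫) atTop
      (𝓝 ⟪(0 : K), T (-k) w⟫) := (hI x).inner tendsto_const_nhds
  rw [inner_zero_left] at h1
  refine tendsto_nhds_unique (tendsto_const_nhds.congr' ?_) h1
  filter_upwards [eventually_ge_atTop k] with N hN
  have e1 : ⟪T 0 x, T (-k) w⟫ = ⟪T 0 (if k = 0 then x else 0), T 0 w⟫ := by
    rw [horth]
    by_cases hk : k = 0 <;> simp [hk]
  have e2 : ∑ l ∈ Finset.range N, ⟪Z (0 - (l + 1)) (ρ l x), T (-k) w⟫ =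
      ∑ l ∈ Finset.range k, ⟪T 0 (φ (k - 1 - l) (ρ l x)), T 0 w⟫ := by
    symm
    apply Finset.sum_subset_zero_on_sdiff (Finset.range_mono hN)
    · intro l hl
      rw [inner_Z_T T Z φ horth hZ, extZ_neg]
      · simp
      · simp at hl; omega
    · intro l hl
      rw [inner_Z_T T Z φ horth hZ, ← extZ_nat φ]
      congr 4
      simp at hl; omega
  rw [inner_sub_left, inner_sub_left, sum_inner, e2, e1, inner_Z_T T Z φ horth hZ]
  have e3 : extZ φ (0 - (-k : ℤ)) = φ k := by rw [← extZ_nat φ k]; congr 1; ring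
  rw [e3]
  conv_lhs => rw [hw]
  rw [map_sub, map_sub, map_sum, inner_sub_left, inner_sub_left, sum_inner]

lemma mul_apply_h (A B : H →L[ℝ] H) (x : H) : (A * B) x = A (B x) := rfl

/-- coefficients of the inverse power series -/
def invC (ρ : ℕ → H →L[ℝ] H) (n : ℕ) : H →L[ℝ] H := if n = 0 then 1 else - ρ (n - 1)

lemma conv_id' (ρ : ℕ → H →L[ℝ] H) (h0 : φ 0 = 1)
    (h : ∀ (k : ℕ) (x : H), φ k x - (if k = 0 then x else 0) -
      ∑ l ∈ Finset.range k, φ (k - 1 - l) (ρ l x) = 0) (k : ℕ) (x : H) :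
    ∑ p ∈ Finset.HasAntidiagonal.antidiagonal k, invC ρ p.1 (φ p.2 x) = if k = 0 then x else 0 := by
  have h1 : PowerSeries.mk φ * PowerSeries.mk (invC ρ) = 1 := by
    ext k x
    rw [PowerSeries.coeff_mul, PowerSeries.coeff_one, ← Finset.Nat.sum_antidiagonal_swap,
      Finset.Nat.sum_antidiagonal_eq_sum_range_succ_mk, Finset.sum_range_succ']
    have hk := h k x
    simp only [PowerSeries.coeff_mk, Prod.swap, add_apply,
      sum_apply, mul_apply_h, invC]
    have : ∀ l ∈ Finset.range k, φ (k - (l + 1)) ((if l + 1 = 0 then 1 else - ρ (l + 1 - 1)) x)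
        = - φ (k - 1 - l) (ρ l x) := by
      intro l hl
      rw [if_neg (by omega), Nat.sub_sub, Nat.add_comm 1 l]
      simp
    rw [Finset.sum_congr rfl this, Finset.sum_neg_distrib]
    have e : (if k = 0 then (1 : H →L[ℝ] H) else 0) x = if k = 0 then x else 0 := by
      split_ifs <;> simp
    rw [e]
    simp only [if_true, Nat.sub_zero, one_apply_eq_self]
    rw [← sub_eq_zero]
    refine Eq.trans ?_ hk
    abel
  have h2 : PowerSeries.mk (invC ρ) * PowerSeries.mk φ = 1 := by
    have h3 := PowerSeries.invOfUnit_mul (PowerSeries.mk φ) 1 (by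
      simp [← PowerSeries.coeff_zero_eq_constantCoeff_apply, h0])
    rw [← left_inv_eq_right_inv h3 h1]
    exact h3
  have h4 := congrArg (fun A => (PowerSeries.coeff k A) x) h2
  simp only [PowerSeries.coeff_mul, PowerSeries.coeff_one, PowerSeries.coeff_mk,
      sum_apply, mul_apply_h] at h4
  rw [h4]
  split_ifs <;> simp

lemma eq_zero_of_uv (ρ : ℕ → H →L[ℝ] H) (hφ : Summable fun j => ‖φ j‖)
    (hρ : Summable fun j => ‖ρ j‖) (w : ℝ) (x : H)
    (h : ∀ k, ∑ p ∈ Finset.HasAntidiagonal.antidiagonal k, invC ρ p.1 (φ p.2 x) = if k = 0 then x else 0)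
    (hu : HasSum (fun j : ℕ => Real.cos (j * w) • φ j x) 0)
    (hv : HasSum (fun j : ℕ => Real.sin (j * w) • φ j x) 0) : x = 0 := by
  have hinv : Summable fun j => ‖invC ρ j‖ := by
    rw [← summable_nat_add_iff 1]
    simpa [invC] using hρ
  let F : ℕ × ℕ → H := fun p => Real.cos ((p.1 + p.2 : ℕ) * w) • invC ρ p.1 (φ p.2 x)
  have hF : Summable F := by
    have hs : Summable fun p : ℕ × ℕ => ‖invC ρ p.1‖ * ‖φ p.2‖ :=
      hinv.mul_of_nonneg hφ (fun _ => norm_nonneg _) (fun _ => norm_nonneg _)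
    refine Summable.of_norm_bounded (hs.mul_right ‖x‖) ?_
    intro p
    simp only [F, norm_smul]
    calc _ ≤ 1 * ‖invC ρ p.1 (φ p.2 x)‖ := by
          gcongr; exact Real.abs_cos_le_one _
      _ ≤ ‖invC ρ p.1‖ * (‖φ p.2‖ * ‖x‖) := by
          rw [one_mul]
          exact (ContinuousLinearMap.le_opNorm _ _).trans
            (by gcongr; exact ContinuousLinearMap.le_opNorm _ _)
      _ = _ := by ring
  have h1 : HasSum F 0 := by
    have : ∑' p, F p = 0 := by
      rw [hF.tsum_prod]
      have : ∀ l : ℕ, ∑' j : ℕ, F (l, j) = 0 := by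
        intro l
        have a := ((invC ρ l).hasSum hu).const_smul (Real.cos (l * w))
        have b := ((invC ρ l).hasSum hv).const_smul (Real.sin (l * w))
        have c := (a.sub b).tsum_eq
        simp only [map_zero, smul_zero, sub_zero] at c
        rw [← c]
        congr 1
        ext1 j
        simp only [F, map_smul, smul_smul, ← sub_smul]
        congr 1
        push_cast
        rw [add_mul, Real.cos_add]
      simp [this]
    rw [← this]; exact hF.hasSum
  have h2 : HasSum (fun s : (Σ k : ℕ, Finset.HasAntidiagonal.antidiagonal k) => F s.2) 0 :=
    (Finset.HasAntidiagonal.sigmaAntidiagonalEquivProd.hasSum_iff (f := F)).2 h1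
  have h3 := h2.sigma (fun k => hasSum_fintype _)
  have h4 : HasSum (fun k : ℕ => if k = 0 then x else 0) 0 := by
    convert h3 using 2 with k
    rw [Finset.univ_eq_attach, Finset.sum_attach (Finset.HasAntidiagonal.antidiagonal k) F]
    have : ∀ p ∈ Finset.HasAntidiagonal.antidiagonal k, F p = Real.cos (k * w) • invC ρ p.1 (φ p.2 x) := by
      intro p hp
      rw [Finset.HasAntidiagonal.mem_antidiagonal] at hp
      simp only [F, hp]
    rw [Finset.sum_congr rfl this, ← Finset.smul_sum, h k]
    split_ifs with hk <;> simp [hk]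
  exact (hasSum_ite_eq (0 : ℕ) x).unique h4

lemma sum_gamma (horth : ∀ n m a b, ⟪T n a, T m b⟫ = if n = m then ⟪T 0 a, T 0 b⟫ else 0)
    (hZ : ∀ n a, Tendsto (fun N : ℕ => ∑ j ∈ Finset.range N, T (n - j) (φ j a)) atTop (𝓝 (Z n a)))
    (hφ : Summable fun j => ‖φ j‖) (w : ℝ) (x u v : H)
    (hu : HasSum (fun j : ℕ => Real.cos (j * w) • φ j x) u)
    (hv : HasSum (fun j : ℕ => Real.sin (j * w) • φ j x) v) :
    HasSum (fun h : ℤ => Real.cos (h * w) * ⟪Z 0 x, Z h x⟫)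
      (⟪T 0 u, T 0 u⟫ + ⟪T 0 v, T 0 v⟫) := by
  let q : H → H → ℝ := fun a b => ⟪T 0 a, T 0 b⟫
  have hq : ∀ a b, ‖q a b‖ ≤ ‖T 0‖ * ‖a‖ * (‖T 0‖ * ‖b‖) := fun a b =>
    (norm_inner_le_norm _ _).trans (by
      gcongr <;> exact ContinuousLinearMap.le_opNorm _ _)
  have hφ' := extZ_summable_norm φ hφ
  let G : ℤ × ℕ → ℝ := fun p => Real.cos (((p.2 : ℤ) - p.1 : ℤ) * w) * q (extZ φ p.1 x) (φ p.2 x)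
  have hG0 : Summable fun p : ℤ × ℕ => ‖q (extZ φ p.1 x) (φ p.2 x)‖ := by
    have hs : Summable fun p : ℤ × ℕ => ‖extZ φ p.1‖ * ‖φ p.2‖ :=
      hφ'.mul_of_nonneg hφ (fun _ => norm_nonneg _) (fun _ => norm_nonneg _)
    refine Summable.of_nonneg_of_le (fun _ => norm_nonneg _) ?_
      (hs.mul_left (‖T 0‖ * ‖T 0‖ * ‖x‖ * ‖x‖))
    intro p
    calc _ ≤ _ := hq _ _
      _ ≤ ‖T 0‖ * (‖extZ φ p.1‖ * ‖x‖) * (‖T 0‖ * (‖φ p.2‖ * ‖x‖)) := by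
          gcongr <;> exact ContinuousLinearMap.le_opNorm _ _
      _ = _ := by ring
  have hG : Summable G := by
    refine Summable.of_norm_bounded hG0 ?_
    intro p
    simp only [G, norm_mul]
    exact mul_le_of_le_one_left (norm_nonneg _) (Real.abs_cos_le_one _)
  have hU : HasSum (fun j : ℤ => Real.cos (j * w) • extZ φ j x) u :=
    extZ_hasSum φ (fun j => Real.cos (j * w)) x u (by simpa using hu)
  have hV : HasSum (fun j : ℤ => Real.sin (j * w) • extZ φ j x) v :=
    extZ_hasSum φ (fun j => Real.sin (j * w)) x v (by simpa using hv)
  have hGsum : HasSum G (q u u + q v v) := by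
    have : ∑' p, G p = q u u + q v v := by
      rw [hG.tsum_prod]
      have h1 : ∀ j : ℤ, ∑' k : ℕ, G (j, k) =
          Real.cos (j * w) * q (extZ φ j x) u + Real.sin (j * w) * q (extZ φ j x) v := by
        intro j
        have a := ((((innerSL ℝ (T 0 (extZ φ j x))).comp (T 0)).hasSum hu).mul_left
          (Real.cos (j * w)))
        have b := ((((innerSL ℝ (T 0 (extZ φ j x))).comp (T 0)).hasSum hv).mul_left
          (Real.sin (j * w)))
        have c := (a.add b).tsum_eq
        simp only [ContinuousLinearMap.comp_apply, innerSL_apply_apply, map_smul, smul_eq_mul] at c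
        refine Eq.trans ?_ c
        congr 1
        ext1 k
        simp only [G, q]
        push_cast
        rw [sub_mul, Real.cos_sub]
        ring
      simp only [h1]
      have a := (((innerSL ℝ (T 0 u)).comp (T 0)).hasSum hU)
      have b := (((innerSL ℝ (T 0 v)).comp (T 0)).hasSum hV)
      have c := (a.add b).tsum_eq
      simp only [ContinuousLinearMap.comp_apply, innerSL_apply_apply, map_smul, smul_eq_mul] at c
      refine Eq.trans ?_ c
      congr 1
      ext1 k
      simp only [q, real_inner_comm (T 0 u), real_inner_comm (T 0 v)]
    rw [← this]; exact hG.hasSum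
  let e : ℤ × ℕ ≃ ℤ × ℕ :=
    { toFun := fun p => ((p.2 : ℤ) - p.1, p.2)
      invFun := fun p => ((p.2 : ℤ) - p.1, p.2)
      left_inv := fun p => by simp
      right_inv := fun p => by simp }
  have h2 : HasSum (G ∘ e) (q u u + q v v) := e.hasSum_iff.2 hGsum
  have h3 := h2.prod_fiberwise (fun h => (h2.summable.prod_factor h).hasSum)
  refine h3.congr_fun ?_
  intro h
  have h5 := ((h2.summable.prod_factor h).hasSum).tendsto_sum_nat
  have h6 : Tendsto (fun N : ℕ => Real.cos (h * w) *
      ⟪Z 0 x, ∑ j ∈ Finset.range N, T (h - j) (φ j x)⟫) atTop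
      (𝓝 (Real.cos (h * w) * ⟪Z 0 x, Z h x⟫)) :=
    ((tendsto_const_nhds).inner (hZ h x)).const_mul _
  refine tendsto_nhds_unique h6 ?_
  refine h5.congr ?_
  intro N
  rw [inner_sum, Finset.mul_sum]
  refine Finset.sum_congr rfl ?_
  intro k _
  rw [inner_Z_T T Z φ horth hZ]
  simp only [G, e, Function.comp_apply, Equiv.coe_fn_mk, q]
  have : (0 : ℤ) - (h - k) = k - h := by ring
  rw [this]
  simp

lemma abstract_pos (horth : ∀ n m a b, ⟪T n a, T m b⟫ = if n = m then ⟪T 0 a, T 0 b⟫ else 0)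
    (hinj : ∀ a, T 0 a = 0 → a = 0)
    (hZ : ∀ n a, Tendsto (fun N : ℕ => ∑ j ∈ Finset.range N, T (n - j) (φ j a)) atTop (𝓝 (Z n a)))
    (h0 : φ 0 = 1) (hφ : Summable fun j => ‖φ j‖)
    (ρ : ℕ → H →L[ℝ] H) (hρ : Summable fun j => ‖ρ j‖)
    (hI : ∀ a, Tendsto (fun N : ℕ => Z 0 a - T 0 a -
      ∑ l ∈ Finset.range N, Z (0 - (l + 1)) (ρ l a)) atTop (𝓝 0))
    (w : ℝ) (x : H) (hx : x ≠ 0) :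
    0 < ∑' h : ℤ, Real.cos (h * w) * ⟪Z 0 x, Z h x⟫ := by
  have hb : ∀ c : ℕ → ℝ, (∀ j, |c j| ≤ 1) → Summable (fun j : ℕ => c j • φ j x) := by
    intro c hc
    refine Summable.of_norm_bounded (hφ.mul_right ‖x‖) ?_
    intro j
    rw [norm_smul]
    exact (mul_le_of_le_one_left (norm_nonneg _) (hc j)).trans
      (ContinuousLinearMap.le_opNorm _ _)
  obtain ⟨u, hu⟩ := hb (fun j => Real.cos (j * w)) (fun j => Real.abs_cos_le_one _)
  obtain ⟨v, hv⟩ := hb (fun j => Real.sin (j * w)) (fun j => Real.abs_sin_le_one _)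
  rw [(sum_gamma T Z φ horth hZ hφ w x u v hu hv).tsum_eq]
  by_contra hcon
  have n1 : 0 ≤ ⟪T 0 u, T 0 u⟫ := real_inner_self_nonneg
  have n2 : 0 ≤ ⟪T 0 v, T 0 v⟫ := real_inner_self_nonneg
  have u0 : u = 0 := hinj u ((inner_self_eq_zero (𝕜 := ℝ)).1 (by linarith))
  have v0 : v = 0 := hinj v ((inner_self_eq_zero (𝕜 := ℝ)).1 (by linarith))
  subst u0 v0
  exact hx (eq_zero_of_uv φ ρ hφ hρ w x
    (fun k => conv_id' φ ρ h0 (fun k x => conv_id T Z φ horth hinj hZ ρ hI k x) k x) hu hv)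

end Abstract

/-! ### Probabilistic part -/

section Prob

variable {Ω : Type*} [MeasurableSpace Ω]
variable {H : Type*} [NormedAddCommGroup H] [InnerProductSpace ℝ H] [CompleteSpace H]
variable {μ : Measure Ω}

lemma outer_apply (x y z : H) : outer x y z = ⟪x, z⟫ • y := rfl

lemma integrable_outer {X Y : Ω → H} (hX : MemLp X 2 μ) (hY : MemLp Y 2 μ) :
    Integrable (fun ω => outer (X ω) (Y ω)) μ := by
  have hint : Integrable (fun ω => ‖X ω‖ * ‖Y ω‖) μ := hX.norm.integrable_mul hY.norm
  refine hint.mono' ?_ ?_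
  · have hc : Continuous fun p : H × H => outer p.1 p.2 := by
      have : Continuous fun p : H × H =>
          ContinuousLinearMap.smulRightL ℝ H H (innerSL ℝ p.1) p.2 := by fun_prop
      exact this
    exact hc.comp_aestronglyMeasurable
      (hX.aestronglyMeasurable.prodMk hY.aestronglyMeasurable)
  · refine Eventually.of_forall fun ω => ?_
    simp [outer, ContinuousLinearMap.norm_smulRight_apply]

lemma crossCov_apply {X Y : Ω → H} (hX : MemLp X 2 μ) (hY : MemLp Y 2 μ) (a : H) :
    crossCov μ X Y a = ∫ ω, ⟪X ω, a⟫ • Y ω ∂μ := by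
  rw [crossCov, ContinuousLinearMap.integral_apply (integrable_outer hX hY)]
  rfl

lemma integrable_cc {X Y : Ω → H} (hX : MemLp X 2 μ) (hY : MemLp Y 2 μ) (a : H) :
    Integrable (fun ω => ⟪X ω, a⟫ • Y ω) μ :=
  (integrable_outer hX hY).apply_continuousLinearMap a

lemma inner_crossCov {X Y : Ω → H} (hX : MemLp X 2 μ) (hY : MemLp Y 2 μ) (a b : H) :
    ⟪crossCov μ X Y a, b⟫ = ∫ ω, ⟪X ω, a⟫ * ⟪Y ω, b⟫ ∂μ := by
  rw [crossCov_apply hX hY, real_inner_comm, ← integral_inner (integrable_cc hX hY a)]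
  refine integral_congr_ae (Eventually.of_forall fun ω => ?_)
  simp only [inner_smul_right, real_inner_comm b]

/-- `a ↦ ⟪f, a⟫` as a bounded operator into `L²`. -/
def cmap (f : Ω → H) (hf : MemLp f 2 μ) : H →L[ℝ] Lp ℝ 2 μ :=
  LinearMap.mkContinuous
    { toFun := fun a => (hf.inner_const a).toLp (fun ω => ⟪f ω, a⟫)
      map_add' := fun a b => by
        rw [← MemLp.toLp_add]
        exact MemLp.toLp_congr _ _ (Eventually.of_forall fun ω => inner_add_right _ _ _)
      map_smul' := fun c a => by
        rw [RingHom.id_apply, ← MemLp.toLp_const_smul]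
        exact MemLp.toLp_congr _ _ (Eventually.of_forall fun ω => real_inner_smul_right _ _ _) }
    ‖hf.toLp f‖ (fun a => by
      rw [mul_comm]
      refine Lp.norm_le_mul_norm_of_ae_le_mul ?_
      filter_upwards [(show MemLp (fun ω => ⟪f ω, a⟫) 2 μ from hf.inner_const a).coeFn_toLp, hf.coeFn_toLp] with ω h1 h2
      simp only [LinearMap.coe_mk, AddHom.coe_mk]
      rw [h1, h2, mul_comm]
      exact norm_inner_le_norm _ _)

lemma cmap_apply (f : Ω → H) (hf : MemLp f 2 μ) (a : H) :
    cmap f hf a = (hf.inner_const a).toLp (fun ω => ⟪f ω, a⟫) := rfl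

lemma cmap_inner {f g : Ω → H} (hf : MemLp f 2 μ) (hg : MemLp g 2 μ) (a b : H) :
    ⟪cmap f hf a, cmap g hg b⟫ = ⟪crossCov μ f g a, b⟫ := by
  rw [inner_crossCov hf hg, L2.inner_def]
  refine integral_congr_ae ?_
  filter_upwards [(show MemLp (fun ω => ⟪f ω, a⟫) 2 μ from hf.inner_const a).coeFn_toLp, (show MemLp (fun ω => ⟪g ω, b⟫) 2 μ from hg.inner_const b).coeFn_toLp] with ω h1 h2
  rw [cmap_apply, cmap_apply, h1, h2]
  simp [mul_comm]

lemma cmap_sub {f g : Ω → H} (hf : MemLp f 2 μ) (hg : MemLp g 2 μ)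
    (h : MemLp (fun ω => f ω - g ω) 2 μ) (a : H) :
    cmap (fun ω => f ω - g ω) h a = cmap f hf a - cmap g hg a := by
  simp only [cmap_apply]
  rw [← MemLp.toLp_sub]
  exact MemLp.toLp_congr _ _ (Eventually.of_forall fun ω => inner_sub_left _ _ _)

lemma cmap_clm {f : Ω → H} (hf : MemLp f 2 μ) (A : H →L[ℝ] H)
    (h : MemLp (fun ω => A (f ω)) 2 μ) (a : H) :
    cmap (fun ω => A (f ω)) h a = cmap f hf (ContinuousLinearMap.adjoint A a) := by
  simp only [cmap_apply]
  exact MemLp.toLp_congr _ _ (Eventually.of_forall fun ω =>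
    (ContinuousLinearMap.adjoint_inner_right _ _ _).symm)

lemma cmap_sum (f : ℕ → Ω → H) (hf : ∀ j, MemLp (f j) 2 μ) (a : H) (N : ℕ)
    (h : MemLp (fun ω => ∑ j ∈ Finset.range N, f j ω) 2 μ) :
    cmap (fun ω => ∑ j ∈ Finset.range N, f j ω) h a =
      ∑ j ∈ Finset.range N, cmap (f j) (hf j) a := by
  induction N with
  | zero =>
    have hz : MemLp (0 : Ω → ℝ) 2 μ := MemLp.zero
    rw [cmap_apply, Finset.sum_range_zero, ← MemLp.toLp_zero hz]
    exact MemLp.toLp_congr _ _ (Eventually.of_forall fun ω => by simp)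
  | succ N ih =>
    have h' : MemLp (fun ω => ∑ j ∈ Finset.range N, f j ω) 2 μ :=
      memLp_finsetSum _ (fun j _ => hf j)
    rw [Finset.sum_range_succ, ← ih h']
    simp only [cmap_apply]
    rw [← MemLp.toLp_add]
    refine MemLp.toLp_congr _ _ (Eventually.of_forall fun ω => ?_)
    simp [Finset.sum_range_succ, inner_add_left]

lemma cmap_tendsto (r : ℕ → Ω → H) (hr : ∀ N, MemLp (r N) 2 μ)
    (h : Tendsto (fun N => ∫ ω, ‖r N ω‖ ^ 2 ∂μ) atTop (𝓝 0)) (a : H) :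
    Tendsto (fun N => cmap (r N) (hr N) a) atTop (𝓝 0) := by
  have h1 : Tendsto (fun N => ‖cmap (r N) (hr N) a‖ ^ 2) atTop (𝓝 0) := by
    have h2 := h.mul_const (‖a‖ ^ 2)
    rw [zero_mul] at h2
    refine squeeze_zero (fun _ => by positivity) (fun N => ?_) h2
    rw [← real_inner_self_eq_norm_sq, cmap_inner, inner_crossCov (hr N) (hr N),
      ← integral_mul_const]
    refine integral_mono ((hr N).inner_const a |>.integrable_mul ((hr N).inner_const a))
      (((hr N).integrable_norm_pow (by norm_num)).mul_const _) (fun ω => ?_)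
    have := abs_real_inner_le_norm (r N ω) a
    change ⟪r N ω, a⟫ * ⟪r N ω, a⟫ ≤ ‖r N ω‖ ^ 2 * ‖a‖ ^ 2
    rw [← mul_pow, ← sq, ← sq_abs]
    gcongr
  rw [tendsto_zero_iff_norm_tendsto_zero]
  have h3 := h1.sqrt
  simpa using h3

lemma proj_inner (ν : ℕ → H) (D : ℕ) (x y : H) : ⟪proj ν D x, y⟫ = ⟪x, proj ν D y⟫ := by
  simp only [proj, sum_apply, ContinuousLinearMap.smulRight_apply, sum_inner, inner_sum,
    innerSL_apply_apply, inner_smul_left, inner_smul_right]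
  refine Finset.sum_congr rfl fun i _ => ?_
  simp [real_inner_comm x, mul_comm]

lemma proj_eq (ν : ℕ → H) (hν : Orthonormal ℝ ν) (D : ℕ) (x : H)
    (hx : x ∈ Submodule.span ℝ (ν '' Set.Iio D)) : proj ν D x = x := by
  induction hx using Submodule.span_induction with
  | mem y hy =>
    obtain ⟨i, hi, rfl⟩ := hy
    simp only [proj, sum_apply, ContinuousLinearMap.smulRight_apply, innerSL_apply_apply]
    rw [Finset.sum_eq_single i]
    · simp [hν.1 i]
    · intro j _ hj
      rw [hν.2 hj, zero_smul]
    · intro h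
      exact absurd (Finset.mem_range.2 hi) h
  | zero => simp
  | add y z _ _ hy hz => rw [map_add, hy, hz]
  | smul c y _ hy => rw [map_smul, hy]

lemma crossCov_proj {X Y : Ω → H} (hX : MemLp X 2 μ) (hY : MemLp Y 2 μ) (ν : ℕ → H) (D : ℕ)
    (a : H) : crossCov μ (fun ω => proj ν D (X ω)) (fun ω => proj ν D (Y ω)) a =
      proj ν D (crossCov μ X Y (proj ν D a)) := by
  have hX' : MemLp (fun ω => proj ν D (X ω)) 2 μ := (proj ν D).comp_memLp' hX
  have hY' : MemLp (fun ω => proj ν D (Y ω)) 2 μ := (proj ν D).comp_memLp' hY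
  rw [crossCov_apply hX' hY', crossCov_apply hX hY,
    ← ContinuousLinearMap.integral_comp_comm _ (integrable_cc hX hY _)]
  refine integral_congr_ae (Eventually.of_forall fun ω => ?_)
  simp only [map_smul, proj_inner]

lemma spec_summable (X : ℤ → Ω → H)
    (hsum : Summable fun h : ℤ => ‖crossCov μ (X 0) (X h)‖) (c : ℤ → ℝ) (hc : ∀ h, |c h| ≤ 1)
    (x : H) : Summable fun h : ℤ => c h • crossCov μ (X 0) (X h) x := by
  refine Summable.of_norm_bounded (hsum.mul_right ‖x‖) fun h => ?_
  rw [norm_smul]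
  exact (mul_le_of_le_one_left (norm_nonneg _) (hc h)).trans (ContinuousLinearMap.le_opNorm _ _)

lemma spec_proj (X : ℤ → Ω → H) (hX : ∀ n, MemLp (X n) 2 μ)
    (hsum : Summable fun h : ℤ => ‖crossCov μ (X 0) (X h)‖) (ν : ℕ → H) (D : ℕ)
    (ω : ℝ) (x y : H) :
    specRe μ (fun n ω' => proj ν D (X n ω')) ω x y =
        proj ν D (specRe μ X ω (proj ν D x) (proj ν D y)) ∧
      specIm μ (fun n ω' => proj ν D (X n ω')) ω x y =
        proj ν D (specIm μ X ω (proj ν D x) (proj ν D y)) := by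
  have sc := fun x => spec_summable X hsum (fun h => Real.cos (h * ω))
    (fun h => Real.abs_cos_le_one _) x
  have ss := fun x => spec_summable X hsum (fun h => Real.sin (h * ω))
    (fun h => Real.abs_sin_le_one _) x
  constructor
  · rw [specRe, specRe, map_smul, (proj ν D).map_tsum ((sc _).add (ss _))]
    simp only [crossCov_proj (hX _) (hX _), map_add, map_smul]
  · rw [specIm, specIm, map_smul, (proj ν D).map_tsum ((sc _).sub (ss _))]
    simp only [crossCov_proj (hX _) (hX _), map_sub, map_smul]

lemma pos_part (X : ℤ → Ω → H) (ε : ℤ → Ω → H) (ψ piOp : ℕ → H →L[ℝ] H)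
    (hF : IsFLP μ X ε ψ) (hI : IsInvertible μ X ε piOp) (hψ : Summable fun j => ‖ψ j‖)
    (hpos : ∀ (c : ℝ) (v : H), v ≠ 0 → covOp μ (ε 0) v = c • v → 0 < c)
    (w : ℝ) (x : H) (hx : x ≠ 0) :
    0 < ∑' h : ℤ, Real.cos (h * w) * ⟪crossCov μ (X 0) (X h) x, x⟫ := by
  obtain ⟨hε, -, -, hcov, hcc⟩ := hF.whiteNoise
  have hX := hF.memLp
  have main := abstract_pos (fun n => cmap (ε n) (hε n)) (fun n => cmap (X n) (hX n))
    (fun j => ContinuousLinearMap.adjoint (ψ j)) ?_ ?_ ?_ ?_ ?_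
    (fun j => ContinuousLinearMap.adjoint (piOp (j + 1))) ?_ ?_ w x hx
  · simpa only [cmap_inner] using main
  · intro n m a b
    simp only [cmap_inner]
    split_ifs with h
    · subst h
      have := hcov n
      simp only [covOp] at this
      rw [this]
    · rw [hcc n m h]; simp
  · intro a ha
    by_contra h0
    refine lt_irrefl (0 : ℝ) (hpos 0 a h0 ?_)
    rw [zero_smul, ← inner_self_eq_zero (𝕜 := ℝ), covOp, ← cmap_inner (hε 0) (hε 0)]
    have ha' : cmap (ε 0) (hε 0) a = 0 := ha
    rw [ha', inner_zero_left]
  · intro n a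
    have hA : ∀ j : ℕ, MemLp (fun ω => ψ j (ε (n - j) ω)) 2 μ :=
      fun j => (ψ j).comp_memLp' (hε _)
    have hS : ∀ N : ℕ, MemLp (fun ω => ∑ j ∈ Finset.range N, ψ j (ε (n - j) ω)) 2 μ :=
      fun N => memLp_finsetSum _ (fun j _ => hA j)
    have hR : ∀ N : ℕ, MemLp (fun ω => X n ω - ∑ j ∈ Finset.range N, ψ j (ε (n - j) ω)) 2 μ :=
      fun N => (hX n).sub (hS N)
    have h1 := cmap_tendsto _ hR (hF.repr n) a
    have h2 := (tendsto_const_nhds (x := cmap (X n) (hX n) a)).sub h1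
    rw [sub_zero] at h2
    refine h2.congr fun N => ?_
    rw [cmap_sub (hX n) (hS N), cmap_sum _ hA, sub_sub_cancel]
    exact Finset.sum_congr rfl fun j _ => cmap_clm (hε _) _ _ _
  · rw [hF.psi_zero]
    exact ContinuousLinearMap.adjoint_id
  · simpa using hψ
  · simpa using hI.1
  · intro a
    have hA : ∀ j : ℕ, MemLp (fun ω => piOp (j + 1) (X (0 - (j + 1)) ω)) 2 μ :=
      fun j => (piOp (j + 1)).comp_memLp' (hX _)
    have hS : ∀ N : ℕ, MemLp (fun ω => ∑ j ∈ Finset.range N,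
        piOp (j + 1) (X (0 - (j + 1)) ω)) 2 μ :=
      fun N => memLp_finsetSum _ (fun j _ => hA j)
    have hD : MemLp (fun ω => X 0 ω - ε 0 ω) 2 μ := (hX 0).sub (hε 0)
    have hR : ∀ N : ℕ, MemLp (fun ω => X 0 ω - ε 0 ω - ∑ j ∈ Finset.range N,
        piOp (j + 1) (X (0 - (j + 1)) ω)) 2 μ :=
      fun N => hD.sub (hS N)
    have h1 := cmap_tendsto _ hR (hI.2 0) a
    refine h1.congr fun N => ?_
    rw [cmap_sub hD (hS N), cmap_sum _ hA, cmap_sub (hX 0) (hε 0)]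
    congr 1
    exact Finset.sum_congr rfl fun j _ => cmap_clm (hX _) _ _ _

end Prob

/-- For a weakly stationary zero-mean process with summable lagged
covariances, the spectral density operator of the projected process satisfies
`F_{X_D}[ω] = P_{A_D} F_X[ω] P_{A_D}` (expressed here on the complexification via the
real/imaginary part maps `specRe`/`specIm`).  If moreover `(X_n)` is a stationary,
invertible functional linear process with `Σ_j ‖ψ_j‖_L < ∞` and all eigenvalues of `C_ε`
positive, then `⟨F_{X_D}[ω]x, x⟩ > 0` for every nonzero `x ∈ A_D`. -/
theorem projected_spectral_density
    {Ω : Type*} [MeasurableSpace Ω] {H : Type*}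
    [NormedAddCommGroup H] [InnerProductSpace ℝ H] [CompleteSpace H]
    (μ : Measure Ω) [IsProbabilityMeasure μ]
    (X : ℤ → Ω → H) (hstat : IsWeaklyStationary μ X)
    (hsum : Summable fun h : ℤ => ‖crossCov μ (X 0) (X h)‖)
    (ν : ℕ → H) (hν : Orthonormal ℝ ν)
    (hνtot : (Submodule.span ℝ (Set.range ν)).topologicalClosure = ⊤)
    (D : ℕ) :
    (∀ ω ∈ Set.Ioc (-Real.pi) Real.pi, ∀ x y : H,
      specRe μ (fun n ω' => proj ν D (X n ω')) ω x y =
        proj ν D (specRe μ X ω (proj ν D x) (proj ν D y)) ∧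
      specIm μ (fun n ω' => proj ν D (X n ω')) ω x y =
        proj ν D (specIm μ X ω (proj ν D x) (proj ν D y))) ∧
    (∀ (ε : ℤ → Ω → H) (ψ piOp : ℕ → H →L[ℝ] H),
      IsFLP μ X ε ψ → IsInvertible μ X ε piOp →
      (Summable fun j => ‖ψ j‖) →
      (∀ (c : ℝ) (v : H), v ≠ 0 → covOp μ (ε 0) v = c • v → 0 < c) →
      ∀ ω ∈ Set.Ioc (-Real.pi) Real.pi,
        ∀ x ∈ Submodule.span ℝ (ν '' Set.Iio D), x ≠ 0 →
          0 < ⟪specRe μ (fun n ω' => proj ν D (X n ω')) ω x 0, x⟫ ∧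
          ⟪specIm μ (fun n ω' => proj ν D (X n ω')) ω x 0, x⟫ = 0) := by
  refine ⟨fun ω _ x y => spec_proj X hstat.1 hsum ν D ω x y, ?_⟩
  intro ε ψ piOp hF hI hψ hpos w _ x hxD hx
  obtain ⟨h1, h2⟩ := spec_proj X hstat.1 hsum ν D w x 0
  rw [h1, h2, proj_inner, proj_inner, proj_eq ν hν D x hxD, map_zero]
  have sc := spec_summable X hsum (fun h => Real.cos (h * w))
    (fun h => Real.abs_cos_le_one _) x
  have ss := spec_summable X hsum (fun h => Real.sin (h * w))
    (fun h => Real.abs_sin_le_one _) x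
  have e1 := (innerSL ℝ x).map_tsum sc
  have e2 := (innerSL ℝ x).map_tsum ss
  simp only [innerSL_apply_apply, inner_smul_right] at e1 e2
  constructor
  · rw [specRe]
    simp only [map_zero, smul_zero, add_zero]
    rw [inner_smul_left, real_inner_comm, e1]
    have := pos_part X ε ψ piOp hF hI hψ hpos w x hx
    simp only [real_inner_comm x] at this ⊢
    refine mul_pos ?_ this
    simp [Real.pi_pos]
  · rw [specIm]
    simp only [map_zero, smul_zero, zero_sub]
    rw [inner_smul_left, tsum_neg, inner_neg_left, real_inner_comm, e2]
    have hsymm : ∀ h : ℤ, ⟪x, crossCov μ (X 0) (X (-h)) x⟫ = ⟪x, crossCov μ (X 0) (X h) x⟫ := by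
      intro h
      have hs := hstat.2.2 0 (-h) h
      rw [zero_add, neg_add_cancel] at hs
      rw [← hs, real_inner_comm, real_inner_comm _ x, inner_crossCov (hstat.1 _) (hstat.1 _),
        inner_crossCov (hstat.1 _) (hstat.1 _)]
      simp only [mul_comm]
    have h0 : ∑' h : ℤ, Real.sin (h * w) * ⟪x, crossCov μ (X 0) (X h) x⟫ = 0 := by
      have := (Equiv.neg ℤ).tsum_eq (fun h : ℤ =>
        Real.sin (h * w) * ⟪x, crossCov μ (X 0) (X h) x⟫)
      simp only [Equiv.neg_apply, hsymm, Int.cast_neg, neg_mul, Real.sin_neg, tsum_neg] at this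
      linarith
    rw [h0]; simp

end FLP
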